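/- Let v₁, v₂, v₃ be a right-handed orthogonal basis of ℝ³. Then for all r, s ∈ ℝ, the vector v₃ × (( ((v₂ − v₃) × (v₁ − r·v₂)) × (v₂ × (v₁ − s·v₃)) ) × v₃) is a nonzero scalar multiple of v₁ − (r − s)·v₂. -/

import Mathlib

open Matrix

theorem vonStaudt_sub (v₁ v₂ v₃ : Fin 3 → ℝ)
    (h1 : v₁ ≠ 0) (h2 : v₂ ≠ 0) (h3 : v₃ ≠ 0)
    (h12 : v₁ ⬝ᵥ v₂ = 0) (h13 : v₁ ⬝ᵥ v₃ = 0) (h23 : v₂ ⬝ᵥ v₃ = 0)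
    (hpos : ∃ l : ℝ, 0 < l ∧ crossProduct v₁ v₂ = l • v₃)
    (r s : ℝ) :
    ∃ c : ℝ, c ≠ 0 ∧
      crossProduct v₃
        (crossProduct
          (crossProduct (crossProduct (v₂ - v₃) (v₁ - r • v₂))
            (crossProduct v₂ (v₁ - s • v₃)))
          v₃)
        = c • (v₁ - (r - s) • v₂) := by
  obtain ⟨l, hl, h⟩ := hpos
  have hq : v₃ ⬝ᵥ v₃ ≠ 0 := fun h0 => h3 (dotProduct_self_eq_zero.mp h0)
  refine ⟨(crossProduct v₁ v₂ ⬝ᵥ v₃) * (v₃ ⬝ᵥ v₃), ?_, ?_⟩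
  · rw [h, smul_dotProduct, smul_eq_mul]
    exact mul_ne_zero (mul_ne_zero hl.ne' hq) hq
  · clear h hq
    have key : ∀ i, crossProduct v₃
        (crossProduct
          (crossProduct (crossProduct (v₂ - v₃) (v₁ - r • v₂))
            (crossProduct v₂ (v₁ - s • v₃)))
          v₃) i = (((crossProduct v₁ v₂ ⬝ᵥ v₃) * (v₃ ⬝ᵥ v₃)) • (v₁ - (r - s) • v₂)) i
          - (crossProduct v₁ v₂ ⬝ᵥ v₃) * (v₁ ⬝ᵥ v₃ - (r - s) * (v₂ ⬝ᵥ v₃)) * v₃ i := by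
      intro i
      fin_cases i <;>
        simp [cross_apply, dotProduct, Fin.sum_univ_three] <;> ring
    ext i
    rw [key i, h13, h23]
    ring
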